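/- arXiv:2406.13794 — 9 statements merged into one kernel-verified Lean document; each statement's English description precedes it below -/
import Mathlib

section
/- Let I ⊆ ℝ be an open interval, let p₀ ∈ I and x₀ ∈ ℝ, and let g, β : ℝ → ℝ be differentiable on I with g′ continuous on I. If for every q ∈ I the zero-expected-loss integral identity β(q)·(g(q) − x₀) = ∫_{p₀}^{q} p·g′(p) dp holds, then for every q ∈ I the optimality differential equation (β(q) − q)·g′(q) + β′(q)·(g(q) − x₀) = 0 holds. -/
open MeasureTheory Set

/-- If the zero-expected-loss integral identity
`β(q)·(g(q) − x₀) = ∫_{p₀}^{q} p·g′(p) dp` holds for every `q` in the open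
interval `I = (a, b)` containing `p₀`, where `g, β` are differentiable on `I`
and `g′` is continuous on `I`, then the optimality differential equation
`(β(q) − q)·g′(q) + β′(q)·(g(q) − x₀) = 0` holds for every `q ∈ I`. -/
theorem stmt_0 (a b p₀ x₀ : ℝ) (g β : ℝ → ℝ)
    (hp₀ : p₀ ∈ Ioo a b)
    (hg : ∀ p ∈ Ioo a b, DifferentiableAt ℝ g p)
    (hβ : ∀ p ∈ Ioo a b, DifferentiableAt ℝ β p)
    (hg' : ContinuousOn (deriv g) (Ioo a b))
    (hint : ∀ q ∈ Ioo a b, β q * (g q - x₀) = ∫ p in p₀..q, p * deriv g p) :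
    ∀ q ∈ Ioo a b, (β q - q) * deriv g q + deriv β q * (g q - x₀) = 0 := by
  intro q hq
  have hcont : ContinuousOn (fun p => p * deriv g p) (Ioo a b) := continuousOn_id.mul hg'
  have hsub : uIcc p₀ q ⊆ Ioo a b := ordConnected_Ioo.uIcc_subset hp₀ hq
  have hintegral : HasDerivAt (fun u => ∫ p in p₀..u, p * deriv g p) (q * deriv g q) q :=
    intervalIntegral.integral_hasDerivAt_right (hcont.mono hsub).intervalIntegrable
      (hcont.stronglyMeasurableAtFilter isOpen_Ioo q hq)
      (hcont.continuousAt (isOpen_Ioo.mem_nhds hq))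
  have hprod : HasDerivAt (fun u => β u * (g u - x₀))
      (deriv β q * (g q - x₀) + β q * deriv g q) q :=
    (hβ q hq).hasDerivAt.mul ((hg q hq).hasDerivAt.sub_const x₀)
  have heq : (fun u => β u * (g u - x₀)) =ᶠ[nhds q] fun u => ∫ p in p₀..u, p * deriv g p :=
    Filter.eventually_of_mem (isOpen_Ioo.mem_nhds hq) hint
  linarith [hprod.unique (hintegral.congr_of_eventuallyEq heq)]
end

section
/- Let I ⊆ ℝ be an open interval, let p₀ ∈ I and x₀ ∈ ℝ, and let g, β : ℝ → ℝ be differentiable on I with g′ and β′ continuous on I. Suppose the optimality differential equation (β(p) − p)·g′(p) + β′(p)·(g(p) − x₀) = 0 holds for every p ∈ I, and that β(p₀)·(g(p₀) − x₀) = 0. Then for every q ∈ I the zero-expected-loss integral identity β(q)·(g(q) − x₀) = ∫_{p₀}^{q} p·g′(p) dp holds. -/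
open MeasureTheory Set

/-- If `g, β` are differentiable on the open interval `I = (a, b)` containing `p₀`,
with `g′` and `β′` continuous on `I`, the optimality differential equation
`(β(p) − p)·g′(p) + β′(p)·(g(p) − x₀) = 0` holds on `I`, and
`β(p₀)·(g(p₀) − x₀) = 0`, then the zero-expected-loss integral identity
`β(q)·(g(q) − x₀) = ∫_{p₀}^{q} p·g′(p) dp` holds for every `q ∈ I`. -/
theorem stmt_1 (a b p₀ x₀ : ℝ) (g β : ℝ → ℝ)
    (hp₀ : p₀ ∈ Ioo a b)
    (hg : ∀ p ∈ Ioo a b, DifferentiableAt ℝ g p)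
    (hβ : ∀ p ∈ Ioo a b, DifferentiableAt ℝ β p)
    (hg' : ContinuousOn (deriv g) (Ioo a b))
    (hβ' : ContinuousOn (deriv β) (Ioo a b))
    (hode : ∀ p ∈ Ioo a b, (β p - p) * deriv g p + deriv β p * (g p - x₀) = 0)
    (hinit : β p₀ * (g p₀ - x₀) = 0) :
    ∀ q ∈ Ioo a b, β q * (g q - x₀) = ∫ p in p₀..q, p * deriv g p := by
  intro q hq
  have hsub : uIcc p₀ q ⊆ Ioo a b := ordConnected_Ioo.uIcc_subset hp₀ hq
  have hderiv : ∀ p ∈ uIcc p₀ q,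
      HasDerivAt (fun p => β p * (g p - x₀)) (p * deriv g p) p := by
    intro p hp
    have hpI := hsub hp
    have hvalue : p * deriv g p = deriv β p * (g p - x₀) + β p * deriv g p := by
      linear_combination -hode p hpI
    rw [hvalue]
    exact (hβ p hpI).hasDerivAt.mul ((hg p hpI).hasDerivAt.sub_const x₀)
  have hint : IntervalIntegrable (fun p => p * deriv g p) volume p₀ q :=
    (continuousOn_id.mul (hg'.mono hsub)).intervalIntegrable
  rw [intervalIntegral.integral_eq_sub_of_hasDerivAt hderiv hint, hinit, sub_zero]
end

section
/- Let K ∈ (0,1) and let p₀, x₀, C be real numbers. Define g : ℝ → ℝ by g(p) = x₀ − C·(p − p₀)^(K/(1−K)) for p > p₀, where the power is the real power. Then for every p > p₀, g has derivative g′(p) = −C·(K/(1−K))·(p − p₀)^(K/(1−K) − 1) at p, and it satisfies (1−K)·(p₀ − p)·g′(p) + K·(g(p) − x₀) = 0; equivalently, with β(p) = (1−K)·p₀ + K·p, the optimality differential equation (β(p) − p)·g′(p) + β′(p)·(g(p) − x₀) = 0 holds at p. -/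
open Set

/-- For `K ∈ (0,1)`, the demand curve `g(p) = x₀ − C·(p − p₀)^(K/(1−K))` has, at
every `p > p₀`, derivative `−C·(K/(1−K))·(p − p₀)^(K/(1−K) − 1)`, satisfies
`(1−K)·(p₀ − p)·g′(p) + K·(g(p) − x₀) = 0`, and, with `β(p) = (1−K)·p₀ + K·p`,
satisfies the optimality differential equation
`(β(p) − p)·g′(p) + β′(p)·(g(p) − x₀) = 0`. -/
theorem stmt_2 (K p₀ x₀ C : ℝ) (hK : K ∈ Ioo (0 : ℝ) 1)
    (g β : ℝ → ℝ)
    (hg : ∀ p, p₀ < p → g p = x₀ - C * (p - p₀) ^ (K / (1 - K)))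
    (hβ : β = fun p => (1 - K) * p₀ + K * p) :
    ∀ p, p₀ < p →
      HasDerivAt g (-C * (K / (1 - K)) * (p - p₀) ^ (K / (1 - K) - 1)) p ∧
      (1 - K) * (p₀ - p) * deriv g p + K * (g p - x₀) = 0 ∧
      (β p - p) * deriv g p + deriv β p * (g p - x₀) = 0 := by
  intro p hp
  have hpos : 0 < p - p₀ := sub_pos.mpr hp
  have hK1 : 1 - K ≠ 0 := (sub_pos.mpr hK.2).ne'
  have hderiv : HasDerivAt g (-C * (K / (1 - K)) * (p - p₀) ^ (K / (1 - K) - 1)) p := by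
    have hformula := ((((hasDerivAt_id p).sub_const p₀).rpow_const (p := K / (1 - K))
      (Or.inl hpos.ne')).const_mul C).const_sub x₀
    refine (hformula.congr_of_eventuallyEq ?_).congr_deriv ?_
    · filter_upwards [Ioi_mem_nhds hp] with q hq using hg q hq
    · simp only [id]
      ring
  have hode : (1 - K) * (p₀ - p) * deriv g p + K * (g p - x₀) = 0 := by
    rw [hderiv.deriv, hg p hp, Real.rpow_sub_one hpos.ne']
    field_simp
    ring
  have hβ' : HasDerivAt β K p := by
    rw [hβ]
    simpa using ((hasDerivAt_id p).const_mul K).const_add ((1 - K) * p₀)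
  refine ⟨hderiv, hode, ?_⟩
  have hβp : β p - p = (1 - K) * (p₀ - p) := by
    rw [hβ]
    ring
  rw [hβp, hβ'.deriv, hode]
end

section
/- Let K ∈ (0,1), let p₀ < a < b and x₀ ∈ ℝ, and let g : ℝ → ℝ be differentiable on the open interval (a, b) satisfying (1−K)·(p₀ − p)·g′(p) + K·(g(p) − x₀) = 0 for all p ∈ (a, b). Then there exists a constant C ∈ ℝ such that g(p) = x₀ − C·(p − p₀)^(K/(1−K)) for all p ∈ (a, b). -/
open Set

/-- For `K ∈ (0,1)` and `p₀ < a < b`, every function `g` differentiable on the open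
interval `(a, b)` satisfying `(1−K)·(p₀ − p)·g′(p) + K·(g(p) − x₀) = 0` on `(a, b)`
is of the form `g(p) = x₀ − C·(p − p₀)^(K/(1−K))` for some constant `C`. -/
theorem stmt_3 (K p₀ a b x₀ : ℝ) (hK : K ∈ Ioo (0 : ℝ) 1)
    (hpa : p₀ < a) (hab : a < b) (g : ℝ → ℝ)
    (hg : ∀ p ∈ Ioo a b, DifferentiableAt ℝ g p)
    (hode : ∀ p ∈ Ioo a b, (1 - K) * (p₀ - p) * deriv g p + K * (g p - x₀) = 0) :
    ∃ C : ℝ, ∀ p ∈ Ioo a b, g p = x₀ - C * (p - p₀) ^ (K / (1 - K)) := by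
  obtain ⟨hK0, hK1⟩ := hK
  have h1K : 0 < 1 - K := sub_pos.2 hK1
  set r := K / (1 - K) with hr
  have hrK : r * (1 - K) = K := div_mul_cancel₀ K h1K.ne'
  have hpos : ∀ p ∈ Ioo a b, 0 < p - p₀ := fun p hp => sub_pos.2 (hpa.trans hp.1)
  have hderiv : ∀ p ∈ Ioo a b,
      HasDerivAt (fun q => (x₀ - g q) * (q - p₀) ^ (-r)) 0 p := by
    intro p hp
    have hu := hpos p hp
    have h := ((hg p hp).hasDerivAt.const_sub x₀).mul
      (((hasDerivAt_id p).sub_const p₀).rpow_const (p := -r) (Or.inl hu.ne'))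
    refine h.congr_deriv ?_
    have hpow : (p - p₀) ^ (-r) = (p - p₀) ^ (-r - 1) * (p - p₀) := by
      rw [Real.rpow_sub_one hu.ne', div_mul_cancel₀ _ hu.ne']
    have hlin : -deriv g p * (p - p₀) - (x₀ - g p) * r = 0 := by
      refine (mul_eq_zero.1 ?_).resolve_left h1K.ne'
      linear_combination hode p hp - (x₀ - g p) * hrK
    simp only [id_eq, hpow]
    linear_combination (p - p₀) ^ (-r - 1) * hlin
  obtain ⟨C, hC⟩ := isOpen_Ioo.exists_is_const_of_deriv_eq_zero isPreconnected_Ioo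
    (fun p hp => (hderiv p hp).differentiableAt.differentiableWithinAt)
    (fun p hp => (hderiv p hp).deriv)
  refine ⟨C, fun p hp => ?_⟩
  have hu := hpos p hp
  rw [← hC p hp, mul_assoc, ← Real.rpow_add hu, neg_add_cancel, Real.rpow_zero]
  ring
end

section
/- Let K ∈ (0,1), κ > 0, and let x₀, C be real numbers. Define g(p) = x₀ − C·(p^(1−K) − κ)^(K/(1−K))·p^(−K), where powers are real powers. Then for every p > 0 with p^(1−K) > κ, g is differentiable at p and satisfies (κ·p^K − p)·g′(p) + κ·K·p^(K−1)·(g(p) − x₀) = 0; equivalently, with β(p) = κ·p^K, the optimality differential equation (β(p) − p)·g′(p) + β′(p)·(g(p) − x₀) = 0 holds at p. -/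
open Set

/-- For `K ∈ (0,1)` and `κ > 0`, the demand curve
`g(p) = x₀ − C·(p^(1−K) − κ)^(K/(1−K))·p^(−K)` is differentiable at every `p > 0`
with `p^(1−K) > κ` and satisfies there
`(κ·p^K − p)·g′(p) + κ·K·p^(K−1)·(g(p) − x₀) = 0`; equivalently, with
`β(p) = κ·p^K`, the optimality differential equation
`(β(p) − p)·g′(p) + β′(p)·(g(p) − x₀) = 0` holds at `p`. -/
theorem stmt_5 (K κ x₀ C : ℝ) (hK : K ∈ Ioo (0 : ℝ) 1) (hκ : 0 < κ)
    (g β : ℝ → ℝ)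
    (hg : g = fun p => x₀ - C * (p ^ (1 - K) - κ) ^ (K / (1 - K)) * p ^ (-K))
    (hβ : β = fun p => κ * p ^ K) :
    ∀ p : ℝ, 0 < p → κ < p ^ (1 - K) →
      DifferentiableAt ℝ g p ∧
      (κ * p ^ K - p) * deriv g p + κ * K * p ^ (K - 1) * (g p - x₀) = 0 ∧
      (β p - p) * deriv g p + deriv β p * (g p - x₀) = 0 := by
  intro p hp hκp
  have hK1 : 1 - K ≠ 0 := (sub_pos.2 hK.2).ne'
  have hw : 0 < p ^ (1 - K) - κ := sub_pos.2 hκp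
  have hg' : HasDerivAt g
      (-(C * ((1 - K) * p ^ (1 - K - 1) * (K / (1 - K)) *
            (p ^ (1 - K) - κ) ^ (K / (1 - K) - 1)) * p ^ (-K) +
          C * (p ^ (1 - K) - κ) ^ (K / (1 - K)) * (-K * p ^ (-K - 1)))) p := by
    rw [hg]
    exact (((((Real.hasDerivAt_rpow_const (p := 1 - K) (Or.inl hp.ne')).sub_const κ).rpow_const
      (p := K / (1 - K)) (Or.inl hw.ne')).const_mul C).mul
      (Real.hasDerivAt_rpow_const (p := -K) (Or.inl hp.ne'))).const_sub x₀
  have hβ' : HasDerivAt β (κ * (K * p ^ (K - 1))) p := by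
    rw [hβ]
    exact (Real.hasDerivAt_rpow_const (Or.inl hp.ne')).const_mul κ
  have hode : (κ * p ^ K - p) * deriv g p + κ * K * p ^ (K - 1) * (g p - x₀) = 0 := by
    have hgp : g p = x₀ - C * (p ^ (1 - K) - κ) ^ (K / (1 - K)) * p ^ (-K) := by rw [hg]
    have hpow : (p ^ (1 - K) - κ) ^ (K / (1 - K)) =
        (p ^ (1 - K) - κ) ^ (K / (1 - K) - 1) * (p ^ (1 - K) - κ) := by
      rw [Real.rpow_sub_one hw.ne', div_mul_cancel₀ _ hw.ne']
    have hP : 0 < p ^ K := Real.rpow_pos_of_pos hp K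
    rw [hg'.deriv, hgp, hpow]
    generalize (p ^ (1 - K) - κ) ^ (K / (1 - K) - 1) = W
    simp only [Real.rpow_sub_one hp.ne', Real.rpow_neg hp.le, Real.rpow_sub hp, Real.rpow_one]
    field_simp
    ring
  refine ⟨hg'.differentiableAt, hode, ?_⟩
  rw [hβ'.deriv, ← mul_assoc]
  simpa only [hβ] using hode
end

section
/- Let K ∈ (0,1), κ > 0, x₀ ∈ ℝ, and let a < b with κ < a^(1−K) (so p^(1−K) > κ for all p ∈ (a,b), a > 0). If g : ℝ → ℝ is differentiable on (a, b) and satisfies (κ·p^K − p)·g′(p) + κ·K·p^(K−1)·(g(p) − x₀) = 0 for all p ∈ (a, b), then there exists a constant C ∈ ℝ such that g(p) = x₀ − C·(p^(1−K) − κ)^(K/(1−K))·p^(−K) for all p ∈ (a, b). -/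
open Set

/-- The reciprocal of `(p^(1-K) - κ)^(K/(1-K)) * p^(-K)` has logarithmic derivative
`-κ K / (p (p^(1-K) - κ))`. -/
lemma hasDerivAt_integratingFactor {K κ p : ℝ} (hK : K < 1) (hp : 0 < p)
    (hu : 0 < p ^ (1 - K) - κ) :
    HasDerivAt (fun x : ℝ => (x ^ (1 - K) - κ) ^ (-(K / (1 - K))) * x ^ K)
      (-((p ^ (1 - K) - κ) ^ (-(K / (1 - K))) * p ^ K) * (κ * K / (p * (p ^ (1 - K) - κ)))) p := by
  have hK' : 1 - K ≠ 0 := by linarith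
  have h1 : HasDerivAt (fun x : ℝ => x ^ (1 - K) - κ) ((1 - K) * p ^ (1 - K - 1)) p :=
    (Real.hasDerivAt_rpow_const (Or.inl hp.ne')).sub_const κ
  have h2 := h1.rpow_const (p := -(K / (1 - K))) (Or.inl hu.ne')
  refine (h2.mul (Real.hasDerivAt_rpow_const (p := K) (Or.inl hp.ne'))).congr_deriv ?_
  rw [Real.rpow_sub_one hu.ne', Real.rpow_sub_one hp.ne', Real.rpow_sub_one hp.ne']
  have hu' := hu.ne'
  generalize (p ^ (1 - K) - κ) ^ (-(K / (1 - K))) = w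
  generalize p ^ (1 - K) = v at *
  field_simp
  ring

/-- For `K ∈ (0,1)`, `κ > 0`, `0 < a < b` with `κ < a^(1−K)`, every function `g`
differentiable on `(a, b)` satisfying
`(κ·p^K − p)·g′(p) + κ·K·p^(K−1)·(g(p) − x₀) = 0` on `(a, b)` is of the form
`g(p) = x₀ − C·(p^(1−K) − κ)^(K/(1−K))·p^(−K)` for some constant `C`. -/
theorem stmt_6 (K κ x₀ a b : ℝ) (hK : K ∈ Ioo (0 : ℝ) 1) (hκ : 0 < κ)
    (ha : 0 < a) (hab : a < b) (hκa : κ < a ^ (1 - K))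
    (g : ℝ → ℝ)
    (hg : ∀ p ∈ Ioo a b, DifferentiableAt ℝ g p)
    (hode : ∀ p ∈ Ioo a b,
      (κ * p ^ K - p) * deriv g p + κ * K * p ^ (K - 1) * (g p - x₀) = 0) :
    ∃ C : ℝ, ∀ p ∈ Ioo a b,
      g p = x₀ - C * (p ^ (1 - K) - κ) ^ (K / (1 - K)) * p ^ (-K) := by
  obtain ⟨hK0, hK1⟩ := hK
  have hpos : ∀ p ∈ Ioo a b, 0 < p := fun p hp => ha.trans hp.1
  have hu : ∀ p ∈ Ioo a b, 0 < p ^ (1 - K) - κ := fun p hp => by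
    have := Real.rpow_lt_rpow ha.le hp.1 (sub_pos.2 hK1)
    linarith
  have hd : ∀ p ∈ Ioo a b, HasDerivAt
      (fun x : ℝ => (g x - x₀) * ((x ^ (1 - K) - κ) ^ (-(K / (1 - K))) * x ^ K)) 0 p := by
    intro p hp
    have hp0 := hpos p hp
    have hup := hu p hp
    refine (((hg p hp).hasDerivAt.sub_const x₀).mul
      (hasDerivAt_integratingFactor hK1 hp0 hup)).congr_deriv ?_
    have hq : 0 < p ^ K := Real.rpow_pos_of_pos hp0 K
    have hpq : p ^ K * p ^ (1 - K) = p := by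
      rw [← Real.rpow_add hp0, add_sub_cancel, Real.rpow_one]
    have hder : deriv g p = κ * K / (p * (p ^ (1 - K) - κ)) * (g p - x₀) := by
      have h := hode p hp
      rw [Real.rpow_sub_one hp0.ne'] at h
      have hup' := hup.ne'
      field_simp at h ⊢
      apply mul_left_cancel₀ hq.ne'
      linear_combination -h + p * deriv g p * hpq
    rw [hder]
    ring
  obtain ⟨C, hC⟩ := isOpen_Ioo.exists_is_const_of_deriv_eq_zero isPreconnected_Ioo
    (fun p hp => (hd p hp).differentiableAt.differentiableWithinAt)
    (fun p hp => (hd p hp).deriv)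
  refine ⟨-C, fun p hp => ?_⟩
  have hp0 := hpos p hp
  have hup := hu p hp
  have hw := (Real.rpow_pos_of_pos hup (K / (1 - K))).ne'
  have hq := (Real.rpow_pos_of_pos hp0 K).ne'
  rw [← hC p hp, Real.rpow_neg hup.le, Real.rpow_neg hp0.le]
  field_simp
  ring
end

section
/- Let σ > 0 and η > 0, and define P : ℕ → ℝ by P(0) = σ² and P(t+1) = η²·P(t)/(P(t) + η²). Then: (i) P is strictly decreasing (strictly antitone); (ii) P(T) < η² for every T ≥ 1; and (iii) P(T) tends to 0 as T → ∞. -/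
open Filter

/-- For `σ, η > 0`, the Kalman variance sequence `P(0) = σ²`,
`P(t+1) = η²·P(t)/(P(t) + η²)` is strictly decreasing, satisfies `P(T) < η²`
for every `T ≥ 1`, and tends to `0` as `T → ∞`. -/
theorem stmt_8 (σ η : ℝ) (hσ : 0 < σ) (hη : 0 < η)
    (P : ℕ → ℝ) (hP0 : P 0 = σ ^ 2)
    (hPs : ∀ t : ℕ, P (t + 1) = η ^ 2 * P t / (P t + η ^ 2)) :
    StrictAnti P ∧ (∀ T : ℕ, 1 ≤ T → P T < η ^ 2) ∧
      Tendsto P atTop (nhds 0) := by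
  have hη2 : 0 < η ^ 2 := by positivity
  have hpos : ∀ t, 0 < P t := by
    intro t
    induction t with
    | zero => rw [hP0]; positivity
    | succ t ih => rw [hPs]; positivity
  have hmul : ∀ t : ℕ, (t : ℝ) * P t < η ^ 2 := by
    intro t
    induction t with
    | zero => simpa using hη2
    | succ t ih =>
      have hp := hpos t
      rw [hPs, ← mul_div_assoc, div_lt_iff₀ (by positivity)]
      push_cast
      nlinarith [mul_lt_mul_of_pos_left ih hη2]
  refine ⟨strictAnti_nat_of_succ_lt fun t => ?_, fun T hT => ?_, ?_⟩
  · have hp := hpos t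
    rw [hPs, div_lt_iff₀ (by positivity)]
    nlinarith [mul_pos hp hp]
  · have hT' : (1 : ℝ) ≤ T := by exact_mod_cast hT
    exact (le_mul_of_one_le_left (hpos T).le hT').trans_lt (hmul T)
  · refine squeeze_zero' (Eventually.of_forall fun t => (hpos t).le) ?_
      (tendsto_const_div_atTop_nhds_zero_nat (η ^ 2))
    filter_upwards [eventually_gt_atTop 0] with t ht
    rw [le_div_iff₀' (by exact_mod_cast ht)]
    exact (hmul t).le
end

section
/- Let θ ∈ (0,1), c > 0, and p₀ > 0. Define the demand curve g(p) = c·p^(θ−1)·(θ/(1−θ))^(1−θ) for p > 0, set x₀ = g(p₀), and define β(p) = ((1−θ)/θ)·p^θ·p₀^(1−θ)·(1 − (p₀/p)^θ)/(1 − (p₀/p)^(1−θ)) for p > 0 with p ≠ p₀. Then for every p > 0 with p ≠ p₀, β and g are differentiable at p and satisfy β′(p)·(g(p) − x₀) + β(p)·g′(p) − p·g′(p) = 0. -/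
open Set

/-- On the positive half-line away from `b`, the posterior-mean price is a quotient of
differences of powers. -/
theorem posteriorMean_eq_div {θ b q : ℝ} (hθ : θ < 1) (hb : 0 < b) (hq : 0 < q) (hqb : q ≠ b) :
    (1 - θ) / θ * q ^ θ * b ^ (1 - θ) * (1 - (b / q) ^ θ) / (1 - (b / q) ^ (1 - θ)) =
      (1 - θ) / θ * (q ^ θ - b ^ θ) / (b ^ (θ - 1) - q ^ (θ - 1)) := by
  have hne : q ^ (1 - θ) ≠ b ^ (1 - θ) := fun h =>
    hqb ((Real.rpow_left_inj hq.le hb.le (sub_ne_zero.2 hθ.ne')).1 h)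
  have hQ : 0 < q ^ (1 - θ) := Real.rpow_pos_of_pos hq _
  have hB : 0 < b ^ (1 - θ) := Real.rpow_pos_of_pos hb _
  have hQ' : 0 < q ^ θ := Real.rpow_pos_of_pos hq _
  rw [Real.div_rpow hb.le hq.le, Real.div_rpow hb.le hq.le, ← neg_sub 1 θ,
    Real.rpow_neg hb.le, Real.rpow_neg hq.le]
  have hsub : q ^ (1 - θ) - b ^ (1 - θ) ≠ 0 := sub_ne_zero.2 hne
  have h₁ : 1 - b ^ (1 - θ) / q ^ (1 - θ) = (q ^ (1 - θ) - b ^ (1 - θ)) / q ^ (1 - θ) := by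
    field_simp
  have h₂ : (b ^ (1 - θ))⁻¹ - (q ^ (1 - θ))⁻¹ =
      (q ^ (1 - θ) - b ^ (1 - θ)) / (b ^ (1 - θ) * q ^ (1 - θ)) := by
    field_simp
  have h₃ : 1 - b ^ θ / q ^ θ = (q ^ θ - b ^ θ) / q ^ θ := by
    field_simp
  rw [h₁, h₂, h₃]
  field_simp

/-- For `θ ∈ (0,1)`, `c > 0`, `p₀ > 0`, the constant mean market maker demand
curve `g(p) = c·p^(θ−1)·(θ/(1−θ))^(1−θ)` with `x₀ = g(p₀)` and the implied
posterior-mean price function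
`β(p) = ((1−θ)/θ)·p^θ·p₀^(1−θ)·(1 − (p₀/p)^θ)/(1 − (p₀/p)^(1−θ))` are
differentiable at every `p > 0` with `p ≠ p₀`, and satisfy there the inverse
optimality differential equation
`β′(p)·(g(p) − x₀) + β(p)·g′(p) − p·g′(p) = 0`. -/
theorem stmt_10 (θ c p₀ x₀ : ℝ) (hθ : θ ∈ Ioo (0 : ℝ) 1) (hc : 0 < c)
    (hp₀ : 0 < p₀) (g β : ℝ → ℝ)
    (hg : g = fun p => c * p ^ (θ - 1) * (θ / (1 - θ)) ^ (1 - θ))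
    (hx₀ : x₀ = g p₀)
    (hβ : β = fun p => (1 - θ) / θ * p ^ θ * p₀ ^ (1 - θ) *
      (1 - (p₀ / p) ^ θ) / (1 - (p₀ / p) ^ (1 - θ))) :
    ∀ p : ℝ, 0 < p → p ≠ p₀ →
      DifferentiableAt ℝ g p ∧ DifferentiableAt ℝ β p ∧
      deriv β p * (g p - x₀) + β p * deriv g p - p * deriv g p = 0 := by
  rintro p hp hne
  obtain ⟨hθ₀, hθ₁⟩ := hθ
  set K := (θ / (1 - θ)) ^ (1 - θ)
  have hpow (a : ℝ) : HasDerivAt (fun q : ℝ => q ^ a) (a * p ^ (a - 1)) p :=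
    Real.hasDerivAt_rpow_const (Or.inl hp.ne')
  have hg' : HasDerivAt g (c * ((θ - 1) * p ^ (θ - 1 - 1)) * K) p :=
    hg ▸ ((hpow (θ - 1)).const_mul c).mul_const K
  have hD : p₀ ^ (θ - 1) - p ^ (θ - 1) ≠ 0 := sub_ne_zero.2 fun h =>
    hne ((Real.rpow_left_inj hp.le hp₀.le (sub_ne_zero.2 hθ₁.ne)).1 h.symm)
  have hβeq : β =ᶠ[nhds p] fun q =>
      (1 - θ) / θ * (q ^ θ - p₀ ^ θ) / (p₀ ^ (θ - 1) - q ^ (θ - 1)) := by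
    filter_upwards [lt_mem_nhds hp, isOpen_ne.mem_nhds hne] with q hq hqne
    rw [hβ]
    exact posteriorMean_eq_div hθ₁ hp₀ hq hqne
  have hβ' := ((((hpow θ).sub_const (p₀ ^ θ)).const_mul ((1 - θ) / θ)).div
    ((hpow (θ - 1)).const_sub (p₀ ^ (θ - 1))) hD).congr_of_eventuallyEq hβeq
  refine ⟨hg'.differentiableAt, hβ'.differentiableAt, ?_⟩
  rw [hβ'.deriv, hg'.deriv, hβeq.eq_of_nhds, hx₀, hg]
  have hpp : p ^ (θ - 1) = p * p ^ (θ - 1 - 1) := by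
    rw [Real.rpow_sub_one hp.ne' (θ - 1)]
    field_simp
  beta_reduce
  generalize p ^ (θ - 1 - 1) = r at *
  rw [hpp] at hD ⊢
  field_simp
  ring
end

section
/- Let θ ∈ (0,1), c > 0, and 0 < p₀ < q. Define the demand curve g(p) = c·p^(θ−1)·(θ/(1−θ))^(1−θ) for p > 0. Then −∫_{p₀}^{q} p·g′(p) dp = c·(θ/(1−θ))^(1−θ)·((1−θ)/θ)·(q^θ − p₀^θ), and consequently the effective trade price (−∫_{p₀}^{q} p·g′(p) dp)/(g(p₀) − g(q)) equals ((1−θ)/θ)·(q^θ − p₀^θ)·(q·p₀)^(1−θ)/(q^(1−θ) − p₀^(1−θ)). -/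
open MeasureTheory Set

/-- The numeraire exchanged along a power-law demand curve. -/
theorem intervalIntegral_mul_deriv_const_mul_rpow {a b r : ℝ} (k : ℝ) (ha : 0 < a) (hb : 0 < b)
    (hr : 0 < r) :
    ∫ p in a..b, p * deriv (fun x : ℝ => k * x ^ (r - 1)) p =
      k * ((r - 1) / r) * (b ^ r - a ^ r) := by
  have hcongr : EqOn (fun p => p * deriv (fun x : ℝ => k * x ^ (r - 1)) p)
      (fun p => k * (r - 1) * p ^ (r - 1)) (uIcc a b) := by
    intro p hp
    have hp0 : 0 < p := (lt_min ha hb).trans_le hp.1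
    have hd := ((Real.hasDerivAt_rpow_const (p := r - 1) (Or.inl hp0.ne')).const_mul k).deriv
    simp only [hd, Real.rpow_sub_one hp0.ne' (r - 1)]
    field_simp
  rw [intervalIntegral.integral_congr hcongr, intervalIntegral.integral_const_mul,
    integral_rpow (Or.inl (by linarith)), sub_add_cancel]
  ring

/-- For `θ ∈ (0,1)`, `c > 0`, `0 < p₀ < q`, and the constant mean market maker
demand curve `g(p) = c·p^(θ−1)·(θ/(1−θ))^(1−θ)`, the numeraire paid in a trade
moving the marginal price from `p₀` to `q` is
`−∫_{p₀}^{q} p·g′(p) dp = c·(θ/(1−θ))^(1−θ)·((1−θ)/θ)·(q^θ − p₀^θ)`, and the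
effective trade price `(−∫_{p₀}^{q} p·g′(p) dp)/(g(p₀) − g(q))` equals
`((1−θ)/θ)·(q^θ − p₀^θ)·(q·p₀)^(1−θ)/(q^(1−θ) − p₀^(1−θ))`. -/
theorem stmt_16 (θ c p₀ q : ℝ) (hθ : θ ∈ Ioo (0 : ℝ) 1) (hc : 0 < c)
    (hp₀ : 0 < p₀) (hpq : p₀ < q) (g : ℝ → ℝ)
    (hg : g = fun p => c * p ^ (θ - 1) * (θ / (1 - θ)) ^ (1 - θ)) :
    (-∫ p in p₀..q, p * deriv g p) =
      c * (θ / (1 - θ)) ^ (1 - θ) * ((1 - θ) / θ) * (q ^ θ - p₀ ^ θ) ∧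
    (-∫ p in p₀..q, p * deriv g p) / (g p₀ - g q) =
      (1 - θ) / θ * (q ^ θ - p₀ ^ θ) * (q * p₀) ^ (1 - θ) /
        (q ^ (1 - θ) - p₀ ^ (1 - θ)) := by
  obtain ⟨hθ0, hθ1⟩ := hθ
  have hq : 0 < q := hp₀.trans hpq
  have h1θ : 0 < 1 - θ := sub_pos.mpr hθ1
  set K := (θ / (1 - θ)) ^ (1 - θ)
  have hK0 : 0 < K := Real.rpow_pos_of_pos (div_pos hθ0 h1θ) _
  have hg' : g = fun p => c * K * p ^ (θ - 1) := by
    rw [hg]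
    funext p
    ring
  have hint : (-∫ p in p₀..q, p * deriv g p) =
      c * K * ((1 - θ) / θ) * (q ^ θ - p₀ ^ θ) := by
    rw [hg', intervalIntegral_mul_deriv_const_mul_rpow _ hp₀ hq hθ0]
    ring
  refine ⟨hint, ?_⟩
  have hinv {x : ℝ} (hx : 0 < x) : x ^ (θ - 1) = (x ^ (1 - θ))⁻¹ := by
    rw [← Real.rpow_neg hx.le, neg_sub]
  have hlt : p₀ ^ (1 - θ) < q ^ (1 - θ) := Real.rpow_lt_rpow hp₀.le hpq h1θ
  have hP : 0 < p₀ ^ (1 - θ) := Real.rpow_pos_of_pos hp₀ _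
  have hQ : 0 < q ^ (1 - θ) := Real.rpow_pos_of_pos hq _
  have hden : g p₀ - g q =
      c * K * (q ^ (1 - θ) - p₀ ^ (1 - θ)) / (q ^ (1 - θ) * p₀ ^ (1 - θ)) := by
    simp only [hg', hinv hp₀, hinv hq]
    field_simp
  have hsub : q ^ (1 - θ) - p₀ ^ (1 - θ) ≠ 0 := (sub_pos.mpr hlt).ne'
  rw [hint, hden, Real.mul_rpow hq.le hp₀.le]
  field_simp
end
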